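/- There is a dense open subset U ⊆ ℂ × ℂ^N such that for all (γ,λ) ∈ U, the image of the operator R(−γ,λ) on ℂ^N ⊗ ℂ^N equals S²(ℂ^N), the space of symmetric tensors. -/

import Mathlib

open scoped BigOperators
open Complex Matrix Filter Topology

noncomputable section

namespace EllipticQG

/-- Jacobi's first theta function `θ(z) = -∑_{j ∈ ℤ+1/2} e^{πij²τ + 2πij(z+1/2)}`. -/
def theta (τ z : ℂ) : ℂ :=
  -∑' j : ℤ, Complex.exp ((Real.pi : ℂ) * Complex.I * ((j : ℂ) + 1 / 2) ^ 2 * τ +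
      2 * (Real.pi : ℂ) * Complex.I * ((j : ℂ) + 1 / 2) * (z + 1 / 2))

/-- `α(z,μ) = θ(z)θ(μ+γ)/(θ(z-γ)θ(μ))`. -/
def alphaF (τ γ z μ : ℂ) : ℂ :=
  theta τ z * theta τ (μ + γ) / (theta τ (z - γ) * theta τ μ)

/-- `β(z,μ) = -θ(z+μ)θ(γ)/(θ(z-γ)θ(μ))`. -/
def betaF (τ γ z μ : ℂ) : ℂ :=
  -(theta τ (z + μ) * theta τ γ) / (theta τ (z - γ) * theta τ μ)

/-- The elliptic dynamical R-matrix of `E_{τ,γ/2}(gl_N)` on `ℂ^N ⊗ ℂ^N`.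
Entry `((i,j),(k,l))` is the coefficient of `e_i ⊗ e_j` in `R (e_k ⊗ e_l)`. -/
def Rmat (N : ℕ) (τ γ z : ℂ) (lam : Fin N → ℂ) :
    Matrix (Fin N × Fin N) (Fin N × Fin N) ℂ := fun p q =>
  if p.1 = p.2 then (if q = p then 1 else 0)
  else (if q = p then alphaF τ γ z (lam p.1 - lam p.2) else 0) +
    (if q = (p.2, p.1) then betaF τ γ z (lam p.1 - lam p.2) else 0)

/-- `λ - γ ∑_{c ∈ S} h^{(c)}` evaluated on the configuration `g` of basis indices. -/
def shiftL {n N : ℕ} (γ : ℂ) (lam : Fin N → ℂ) (S : Finset (Fin n)) (g : Fin n → Fin N) :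
    Fin N → ℂ :=
  fun i => lam i - γ * ((S.filter fun c => g c = i).card : ℂ)

/-- `R(z, λ - γ ∑_{c∈S} h^{(c)})^{(a b)}` acting on `(ℂ^N)^{⊗ n}`. -/
def Rop (N n : ℕ) (τ γ z : ℂ) (lam : Fin N → ℂ) (S : Finset (Fin n)) (a b : Fin n) :
    Matrix (Fin n → Fin N) (Fin n → Fin N) ℂ := fun f g =>
  if ∀ c, c ≠ a → c ≠ b → f c = g c then
    Rmat N τ γ z (shiftL γ lam S g) (f a, f b) (g a, g b)
  else 0

/-- The operators `W_n(z,λ)`, defined recursively:  `W_1 = 1` and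
`W_{n+1}(z,λ) = R(z_1-z_2, λ-γ∑_{j=3}^{n+1}h^{(j)})^{(12)} ⋯ R(z_1-z_{n+1},λ)^{(1 n+1)}
  (1 ⊗ W_n(z_2,…,z_{n+1}, λ-γh^{(1)}))` (tensor factors indexed `0,…,n`). -/
def Wrec (N : ℕ) (τ γ : ℂ) : (n : ℕ) → (Fin n → ℂ) → (Fin N → ℂ) →
    Matrix (Fin n → Fin N) (Fin n → Fin N) ℂ
  | 0, _, _ => 1
  | n + 1, z, lam =>
    (((List.finRange n).map fun j : Fin n =>
      Rop N (n + 1) τ γ (z 0 - z j.succ) lam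
        (Finset.univ.filter fun c : Fin (n + 1) => j.succ < c) 0 j.succ).prod) *
      Matrix.of (fun f g : Fin (n + 1) → Fin N =>
        if f 0 = g 0 then
          Wrec N τ γ n (fun j => z j.succ) (fun i => lam i - if g 0 = i then γ else 0)
            (Fin.tail f) (Fin.tail g)
        else 0)

/-- `W^S_n(λ) = W_n(z^S, λ)` with `z^S = (0, γ, 2γ, …, (n-1)γ)`. -/
def WS (N n : ℕ) (τ γ : ℂ) (lam : Fin N → ℂ) :
    Matrix (Fin n → Fin N) (Fin n → Fin N) ℂ :=
  Wrec N τ γ n (fun j => ((j : ℕ) : ℂ) * γ) lam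

/-- `z^∧ = ((n-1)γ, …, 2γ, γ, 0)`. -/
def zWedge (n : ℕ) (γ : ℂ) : Fin n → ℂ := fun j => ((n - 1 - (j : ℕ) : ℕ) : ℂ) * γ

/-- `W^∧_n(λ) = lim_{z → z^∧} ∏_{j=1}^{n-1} (z_j - z_{j+1} - γ) · ρ W_n(z,λ) ρ`,
where `ρ` reverses the order of the tensor factors. -/
def Wwedge (N n : ℕ) (τ γ : ℂ) (lam : Fin N → ℂ) :
    Matrix (Fin n → Fin N) (Fin n → Fin N) ℂ :=
  limUnder (𝓝[≠] zWedge n γ) fun z : Fin n → ℂ =>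
    (∏ j : Fin n, if h : (j : ℕ) + 1 < n then z j - z ⟨(j : ℕ) + 1, h⟩ - γ else 1) •
      Matrix.of fun f g : Fin n → Fin N => Wrec N τ γ n z lam (f ∘ Fin.rev) (g ∘ Fin.rev)

/-- The space `S²(ℂ^N)` of symmetric tensors in `ℂ^N ⊗ ℂ^N`. -/
def symPair (N : ℕ) : Submodule ℂ ((Fin N × Fin N) → ℂ) where
  carrier := {v | ∀ p : Fin N × Fin N, v p = v (p.2, p.1)}
  add_mem' := by intro a b ha hb p; simp only [Pi.add_apply, ha p, hb p]
  zero_mem' := by intro p; rfl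
  smul_mem' := by intro c v hv p; simp only [Pi.smul_apply, hv p]

/-- `R^{reg}(γ,λ) = lim_{z→γ} (z-γ) R(z,λ)`. -/
def Rreg (N : ℕ) (τ γ : ℂ) (lam : Fin N → ℂ) : Matrix (Fin N × Fin N) (Fin N × Fin N) ℂ :=
  limUnder (𝓝[≠] γ) fun z : ℂ => (z - γ) • Rmat N τ γ z lam

/-- The flip `P : u ⊗ v ↦ v ⊗ u` on `ℂ^N ⊗ ℂ^N`. -/
def Pmat (N : ℕ) : Matrix (Fin N × Fin N) (Fin N × Fin N) ℂ := fun p q =>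
  if q = (p.2, p.1) then 1 else 0

/-- The space `S^n(ℂ^N)` of symmetric tensors in `(ℂ^N)^{⊗n}`. -/
def symTensors (N n : ℕ) : Submodule ℂ ((Fin n → Fin N) → ℂ) where
  carrier := {v | ∀ (σ : Equiv.Perm (Fin n)) (f : Fin n → Fin N), v (f ∘ σ) = v f}
  add_mem' := by intro a b ha hb σ f; simp only [Pi.add_apply, ha σ f, hb σ f]
  zero_mem' := by intro σ f; rfl
  smul_mem' := by intro c v hv σ f; simp only [Pi.smul_apply, hv σ f]

/-- `J_n(ℂ^N)`: the span of tensors `σ v - sign(σ) v`. -/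
def Jspan (N n : ℕ) : Submodule ℂ ((Fin n → Fin N) → ℂ) :=
  Submodule.span ℂ {w | ∃ (σ : Equiv.Perm (Fin n)) (v : (Fin n → Fin N) → ℂ),
    w = (fun f => v (f ∘ σ)) - ((Equiv.Perm.sign σ : ℤ) : ℂ) • v}

/-- `ℂ^N ⊗ W ⊆ ℂ^N ⊗ (ℂ^N)^{⊗ n}` for a subspace `W ⊆ (ℂ^N)^{⊗ n}`. -/
def consSlice (N n : ℕ) (W : Submodule ℂ ((Fin n → Fin N) → ℂ)) :
    Submodule ℂ ((Fin (n + 1) → Fin N) → ℂ) where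
  carrier := {v | ∀ i : Fin N, (fun g : Fin n → Fin N => v (Fin.cons i g)) ∈ W}
  add_mem' := by intro a b ha hb i; exact W.add_mem (ha i) (hb i)
  zero_mem' := by intro i; exact W.zero_mem
  smul_mem' := by intro c v hv i; exact W.smul_mem c (hv i)

/-- The `L`-operator of `V^{⊗n}(w)`:
`L(z,λ) = R(z-w, λ-γ∑_{j=2}^n h^{(j)})^{(01)} ⋯ R(z-w-γ(n-1), λ)^{(0n)}`,
acting on `ℂ^N ⊗ (ℂ^N)^{⊗n}` with factors numbered `0,…,n`. -/
def Lop (N n : ℕ) (τ γ z w : ℂ) (lam : Fin N → ℂ) :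
    Matrix (Fin (n + 1) → Fin N) (Fin (n + 1) → Fin N) ℂ :=
  ((List.finRange n).map fun j : Fin n =>
    Rop N (n + 1) τ γ (z - w - (j : ℕ) * γ) lam
      (Finset.univ.filter fun c : Fin (n + 1) => j.succ < c) 0 j.succ).prod

/-- The `L`-operator for the opposite coproduct:
`L'(z,λ) = R(z-w-γ(n-1), λ-γ∑_{j=1}^{n-1} h^{(j)})^{(0n)} ⋯ R(z-w, λ)^{(01)}`. -/
def Lop' (N n : ℕ) (τ γ z w : ℂ) (lam : Fin N → ℂ) :
    Matrix (Fin (n + 1) → Fin N) (Fin (n + 1) → Fin N) ℂ :=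
  (((List.finRange n).reverse).map fun j : Fin n =>
    Rop N (n + 1) τ γ (z - w - (j : ℕ) * γ) lam
      (Finset.univ.filter fun c : Fin (n + 1) => 0 < c ∧ c < j.succ) 0 j.succ).prod

/-- `Id ⊗ M` on `ℂ^N ⊗ (ℂ^N)^{⊗n}`. -/
def idTensor (N n : ℕ) (M : Matrix (Fin n → Fin N) (Fin n → Fin N) ℂ) :
    Matrix (Fin (n + 1) → Fin N) (Fin (n + 1) → Fin N) ℂ :=
  Matrix.of fun f g => if f 0 = g 0 then M (Fin.tail f) (Fin.tail g) else 0

/-- `Id ⊗ M(λ - γ h^{(0)})` on `ℂ^N ⊗ (ℂ^N)^{⊗n}`. -/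
def idTensorShift (N n : ℕ) (γ : ℂ)
    (M : (Fin N → ℂ) → Matrix (Fin n → Fin N) (Fin n → Fin N) ℂ) (lam : Fin N → ℂ) :
    Matrix (Fin (n + 1) → Fin N) (Fin (n + 1) → Fin N) ℂ :=
  Matrix.of fun f g =>
    if f 0 = g 0 then M (fun i => lam i - if g 0 = i then γ else 0) (Fin.tail f) (Fin.tail g)
    else 0

/-- The zero-weight symmetric tensor `e`: the sum of all `e_{i_1} ⊗ ⋯ ⊗ e_{i_n}` over
sequences in which each index occurs exactly `ℓ` times. -/
def evec (N n ℓ : ℕ) : (Fin n → Fin N) → ℂ := fun f =>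
  if ∀ i : Fin N, (Finset.univ.filter fun j => f j = i).card = ℓ then 1 else 0

/-- The multi-index of `ē = e_1^{⊗ℓ} ⊗ ⋯ ⊗ e_N^{⊗ℓ}`. -/
def barIdx (N ℓ : ℕ) : Fin (N * ℓ) → Fin N := fun j =>
  ⟨j.val / ℓ, by
    have h : (j : ℕ) < ℓ * N := by rw [Nat.mul_comm ℓ N]; exact j.isLt
    exact Nat.div_lt_of_lt_mul h⟩

/-- `g_{N,ℓ}(λ) = ∏_{1≤j<k≤N} ∏_{s=1}^ℓ θ(λ_j-λ_k+γs)/θ(λ_j-λ_k-γ(s-1))`. -/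
def gfun (N ℓ : ℕ) (τ γ : ℂ) (lam : Fin N → ℂ) : ℂ :=
  ∏ j : Fin N, ∏ k : Fin N,
    if j < k then
      ∏ s ∈ Finset.Icc 1 ℓ,
        theta τ (lam j - lam k + γ * (s : ℂ)) / theta τ (lam j - lam k - γ * ((s : ℂ) - 1))
    else 1

/-- The permutation induced by a word in the generators `s_1, …, s_n` of `S_{n+1}`:
`π_k = s_{a_1} ∘ ⋯ ∘ s_{a_k}` (letters `a` act as the transposition of `a` and `a+1`). -/
def permOfWord {n : ℕ} : List (Fin n) → Equiv.Perm (Fin (n + 1))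
  | [] => 1
  | a :: rest => Equiv.swap a.castSucc a.succ * permOfWord rest

/-- The product of R-matrices attached to a word (with accumulated permutation `π`):
`W_w(z,λ) = F_k ⋯ F_1` where for the `t`-th letter `a`
`F_t = R(z_{π(a)} - z_{π(a+1)}, λ - γ ∑_{b<a} h^{(π(b))})^{(π(a), π(a+1))}`,
`π = π_{t-1}` the permutation induced by the earlier letters. -/
def Wword (N : ℕ) {n : ℕ} (τ γ : ℂ) (z : Fin (n + 1) → ℂ) (lam : Fin N → ℂ) :
    List (Fin n) → Equiv.Perm (Fin (n + 1)) →
      Matrix (Fin (n + 1) → Fin N) (Fin (n + 1) → Fin N) ℂ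
  | [], _ => 1
  | a :: rest, π =>
      Wword N τ γ z lam rest (π * Equiv.swap a.castSucc a.succ) *
        Rop N (n + 1) τ γ (z (π a.castSucc) - z (π a.succ)) lam
          ((Finset.univ.filter fun c : Fin (n + 1) => (c : ℕ) < (a : ℕ)).image π)
          (π a.castSucc) (π a.succ)

/-- The fused R-matrix `𝓡_{V^{⊗m}(z), V^{⊗n}(w)}(λ)` on `(ℂ^N)^{⊗(m+n)}`
(first block: factors `0,…,m-1`; second block: factors `m,…,m+n-1`). -/
def Rmn (N m n : ℕ) (τ γ z w : ℂ) (lam : Fin N → ℂ) :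
    Matrix (Fin (m + n) → Fin N) (Fin (m + n) → Fin N) ℂ :=
  ((List.finRange m).map fun a : Fin m =>
    ((List.finRange n).map fun j : Fin n =>
      Rop N (m + n) τ γ (z + (a : ℕ) * γ - w - (j : ℕ) * γ) lam
        (Finset.univ.filter fun c : Fin (m + n) =>
          (c : ℕ) < (a : ℕ) ∨ m + (j : ℕ) < (c : ℕ))
        (Fin.castAdd n a) (Fin.natAdd m j)).prod).prod

/-- `A ⊗ B ⊆ (ℂ^N)^{⊗m} ⊗ (ℂ^N)^{⊗n}`, realised as `(A ⊗ V₂) ∩ (V₁ ⊗ B)`. -/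
def blockSub (N m n : ℕ) (A : Submodule ℂ ((Fin m → Fin N) → ℂ))
    (B : Submodule ℂ ((Fin n → Fin N) → ℂ)) :
    Submodule ℂ ((Fin (m + n) → Fin N) → ℂ) where
  carrier := {v |
    (∀ g : Fin n → Fin N, (fun f : Fin m → Fin N => v (Fin.append f g)) ∈ A) ∧
    ∀ f : Fin m → Fin N, (fun g : Fin n → Fin N => v (Fin.append f g)) ∈ B}
  add_mem' := by
    intro x y hx hy
    exact ⟨fun g => A.add_mem (hx.1 g) (hy.1 g), fun f => B.add_mem (hx.2 f) (hy.2 f)⟩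
  zero_mem' := ⟨fun _ => A.zero_mem, fun _ => B.zero_mem⟩
  smul_mem' := by
    intro c x hx
    exact ⟨fun g => A.smul_mem c (hx.1 g), fun f => B.smul_mem c (hx.2 f)⟩

/-- Matrix element `L_{jk}(z,λ)` of the `L`-operator (evaluation point `w = 0`),
as an operator on `(ℂ^N)^{⊗n}`: `L(z,λ)(e_k ⊗ v) = ∑_j e_j ⊗ L_{jk}(z,λ) v`. -/
def LmatEl (N n : ℕ) (τ γ z : ℂ) (lam : Fin N → ℂ) (j k : Fin N)
    (v : (Fin n → Fin N) → ℂ) : (Fin n → Fin N) → ℂ := fun g =>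
  (Lop N n τ γ z 0 lam).mulVec
    (fun f => (if f 0 = k then (1 : ℂ) else 0) * v (Fin.tail f)) (Fin.cons j g)

/-- `L_{j_{σ(1)} j_1}(z, λ-γ(ω_{j_2}+⋯+ω_{j_m})) ∘ ⋯ ∘ L_{j_{σ(m)} j_m}(z-(m-1)γ, λ)`. -/
def chainT (N n m : ℕ) (τ γ z : ℂ) (lam : Fin N → ℂ) (jt : Fin m → Fin N)
    (σ : Equiv.Perm (Fin m)) (v : (Fin n → Fin N) → ℂ) : (Fin n → Fin N) → ℂ :=
  (List.finRange m).foldr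
    (fun (t : Fin m) acc =>
      LmatEl N n τ γ (z - (t.val : ℂ) * γ)
        (fun i => lam i -
          γ * ((Finset.univ.filter fun s : Fin m => t < s ∧ jt s = i).card : ℂ))
        (jt (σ t)) (jt t) acc)
    v

/-- The transfer matrix `T_m(z)`, acting on scalar functions of `λ` via the identification
of the zero weight space of `S^{Nℓ}(ℂ^N)` with `ℂ` by the basis vector `e`:
`T_m(z) f(λ) = ∑_{j_1<⋯<j_m} ∑_{σ} (-1)^σ [L_{j_{σ(1)} j_1}(z,λ-γ(ω_{j_2}+⋯+ω_{j_m})) ⋯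
L_{j_{σ(m)} j_m}(z-(m-1)γ, λ)] e · f(λ-γ(ω_{j_1}+⋯+ω_{j_m}))`. -/
def Tm (N ℓ m : ℕ) (τ γ z : ℂ) (lam : Fin N → ℂ) (f : (Fin N → ℂ) → ℂ) : ℂ :=
  ∑ jt ∈ Finset.univ.filter fun jt : Fin m → Fin N => ∀ s t : Fin m, s < t → jt s < jt t,
    ∑ σ : Equiv.Perm (Fin m),
      ((Equiv.Perm.sign σ : ℤ) : ℂ) *
        chainT N (N * ℓ) m τ γ z lam jt σ (evec N (N * ℓ) ℓ) (barIdx N ℓ) *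
        f fun i => lam i - if ∃ t, jt t = i then γ else 0

/-- The `m`-th Ruijsenaars operator with coupling constant `ℓ`:
`M_m f(λ) = ∑_{|J|=m} ∏_{j∈J,k∉J} θ(λ_j-λ_k+ℓγ)/θ(λ_j-λ_k) · f(λ-γ∑_{j∈J}ω_j)`. -/
def Mm (N ℓ m : ℕ) (τ γ : ℂ) (f : (Fin N → ℂ) → ℂ) (lam : Fin N → ℂ) : ℂ :=
  ∑ J ∈ Finset.powersetCard m (Finset.univ : Finset (Fin N)),
    (∏ j ∈ J, ∏ k ∈ Jᶜ, theta τ (lam j - lam k + (ℓ : ℂ) * γ) / theta τ (lam j - lam k)) *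
      f fun i => lam i - if i ∈ J then γ else 0

/-- The transfer matrix with auxiliary space indexed by `ι` (weights `wt`) and quantum
space indexed by `ι₃`: `T f(λ) = ∑_μ tr_{W[μ]}(𝓡(λ)) f(λ-γμ)`. -/
def transferOp {N : ℕ} {ι ι₃ : Type} [Fintype ι] [Fintype ι₃] (γ : ℂ)
    (wt : ι → Fin N → ℂ) (R : (Fin N → ℂ) → Matrix (ι × ι₃) (ι × ι₃) ℂ)
    (f : (Fin N → ℂ) → ι₃ → ℂ) : (Fin N → ℂ) → ι₃ → ℂ := fun lam b =>
  ∑ a : ι, ∑ b' : ι₃, R lam (a, b) (a, b') * f (fun r => lam r - γ * wt a r) b'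


/-- The theta function is odd. -/
lemma theta_neg (τ z : ℂ) : theta τ (-z) = -theta τ z := by
  unfold theta
  rw [neg_neg, ← tsum_neg, ← (Equiv.subLeft (-1 : ℤ)).tsum_eq]
  refine tsum_congr fun j => ?_
  have key : cexp (-(2 * Real.pi * I * ((j : ℂ) + 1 / 2))) = -1 := by
    rw [show -(2 * Real.pi * I * ((j : ℂ) + 1 / 2)) =
        -(Real.pi * I) + ((-j : ℤ) : ℂ) * (2 * Real.pi * I) by push_cast; ring,
      Complex.exp_add, Complex.exp_int_mul_two_pi_mul_I, Complex.exp_neg, Complex.exp_pi_mul_I]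
    norm_num
  simp only [Equiv.subLeft_apply]
  rw [neg_eq_iff_eq_neg, ← neg_one_mul (cexp _), ← key, ← Complex.exp_add]
  congr 1
  push_cast
  ring

/-- `θ` in terms of Mathlib's two-variable Jacobi theta function. -/
lemma theta_eq_jacobiTheta₂ (τ z : ℂ) :
    theta τ z = -(cexp (Real.pi * I * τ / 4 + Real.pi * I * (z + 1 / 2)) *
      jacobiTheta₂ (z + 1 / 2 + τ / 2) τ) := by
  unfold theta jacobiTheta₂
  rw [← tsum_mul_left]
  congr 1
  refine tsum_congr fun j => ?_
  rw [jacobiTheta₂_term, ← Complex.exp_add]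
  congr 1
  ring

lemma differentiable_theta {τ : ℂ} (hτ : 0 < τ.im) : Differentiable ℂ (theta τ) := by
  have h : Differentiable ℂ fun z => jacobiTheta₂ z τ :=
    fun z => differentiableAt_jacobiTheta₂_fst z hτ
  rw [funext (theta_eq_jacobiTheta₂ τ)]
  have h2 : Differentiable ℂ fun z => jacobiTheta₂ (z + 1 / 2 + τ / 2) τ :=
    h.comp (f := fun z : ℂ => z + 1 / 2 + τ / 2) (by fun_prop)
  fun_prop

/-- The zeroth Fourier coefficient of `x ↦ jacobiTheta₂ x τ` is `1`. -/
lemma integral_jacobiTheta₂ {τ : ℂ} (hτ : 0 < τ.im) :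
    ∫ x in (0 : ℝ)..1, jacobiTheta₂ x τ = 1 := by
  have hterm : ∀ n : ℤ, ∫ x in (0 : ℝ)..1, jacobiTheta₂_term n x τ = if n = 0 then 1 else 0 := by
    intro n
    split_ifs with hn
    · simp [hn, jacobiTheta₂_term]
    · have hc : 2 * Real.pi * I * (n : ℂ) ≠ 0 := by
        simp [hn, Real.pi_ne_zero]
      simp only [jacobiTheta₂_term, Complex.exp_add]
      rw [intervalIntegral.integral_mul_const, integral_exp_mul_complex hc]
      rw [show 2 * Real.pi * I * (n : ℂ) * (1 : ℝ) = n * (2 * Real.pi * I) by push_cast; ring,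
        Complex.exp_int_mul_two_pi_mul_I]
      simp
  have hs := intervalIntegral.hasSum_integral_of_dominated_convergence
    (μ := MeasureTheory.volume) (a := (0 : ℝ)) (b := 1)
    (F := fun (n : ℤ) (x : ℝ) => jacobiTheta₂_term n x τ)
    (f := fun x : ℝ => jacobiTheta₂ x τ)
    (fun n _ => ‖jacobiTheta₂_term n 0 τ‖)
    (fun n => by unfold jacobiTheta₂_term; fun_prop)
    (fun n => by simp [norm_jacobiTheta₂_term])
    (MeasureTheory.ae_of_all _ fun _ _ => ((summable_jacobiTheta₂_term_iff 0 τ).2 hτ).norm)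
    (by simp)
    (MeasureTheory.ae_of_all _ fun x _ => hasSum_jacobiTheta₂_term (x : ℂ) hτ)
  simp only [hterm] at hs
  exact hs.unique (hasSum_ite_eq 0 1)

lemma dense_theta_ne_zero {τ : ℂ} (hτ : 0 < τ.im) : Dense {z | theta τ z ≠ 0} := by
  intro z
  by_contra hz
  rw [mem_closure_iff_frequently, not_frequently] at hz
  have hzero : theta τ = 0 :=
    AnalyticOnNhd.eq_of_eventuallyEq
      (fun w _ => (differentiable_theta hτ).analyticAt w) (fun w _ => analyticAt_const)
      (hz.mono fun w hw => by simpa using hw)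
  have hj : ∀ w, jacobiTheta₂ w τ = 0 := by
    intro w
    have := theta_eq_jacobiTheta₂ τ (w - 1 / 2 - τ / 2)
    rw [hzero, show w - 1 / 2 - τ / 2 + 1 / 2 + τ / 2 = w by ring] at this
    simpa using this
  simpa [hj] using integral_jacobiTheta₂ hτ

lemma isOpen_dense_theta_comp_ne_zero {τ : ℂ} (hτ : 0 < τ.im) {E : Type*} [AddCommGroup E]
    [Module ℂ E] [TopologicalSpace E] [ContinuousAdd E] [ContinuousSMul ℂ E]
    (L : E →L[ℂ] ℂ) (hL : L ≠ 0) :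
    IsOpen {x | theta τ (L x) ≠ 0} ∧ Dense {x | theta τ (L x) ≠ 0} :=
  ⟨isOpen_ne_fun ((differentiable_theta hτ).continuous.comp L.continuous) continuous_const,
    (dense_theta_ne_zero hτ).preimage (L.isOpenMap_of_ne_zero hL)⟩

/-- This symmetry makes the rows `(i,j)` and `(j,i)` of `R(-γ,λ)` coincide. -/
lemma betaF_neg_gamma_neg (τ γ μ : ℂ) : betaF τ γ (-γ) (-μ) = alphaF τ γ (-γ) μ := by
  unfold alphaF betaF
  rw [← neg_add, theta_neg, theta_neg, theta_neg, add_comm γ μ, mul_neg, div_neg, ← neg_div]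
  ring

lemma Rmat_mulVec_of_eq {N : ℕ} (τ γ z : ℂ) (lam : Fin N → ℂ) (w : Fin N × Fin N → ℂ)
    (i : Fin N) : (Rmat N τ γ z lam *ᵥ w) (i, i) = w (i, i) := by
  simp [Matrix.mulVec, dotProduct, Rmat]

lemma Rmat_mulVec_of_ne {N : ℕ} (τ γ z : ℂ) (lam : Fin N → ℂ) (w : Fin N × Fin N → ℂ)
    {i j : Fin N} (hij : i ≠ j) :
    (Rmat N τ γ z lam *ᵥ w) (i, j) =
      alphaF τ γ z (lam i - lam j) * w (i, j) + betaF τ γ z (lam i - lam j) * w (j, i) := by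
  simp [Matrix.mulVec, dotProduct, Rmat, hij, add_mul, Finset.sum_add_distrib]

lemma Rmat_neg_gamma_mulVec_of_ne {N : ℕ} (τ γ : ℂ) (lam : Fin N → ℂ) (w : Fin N × Fin N → ℂ)
    {i j : Fin N} (hij : i ≠ j) :
    (Rmat N τ γ (-γ) lam *ᵥ w) (i, j) =
      alphaF τ γ (-γ) (lam i - lam j) * w (i, j) +
        alphaF τ γ (-γ) (lam j - lam i) * w (j, i) := by
  rw [Rmat_mulVec_of_ne _ _ _ _ _ hij, ← betaF_neg_gamma_neg τ γ (lam j - lam i), neg_sub]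

/-- The image of `R(-γ,λ)` is the space of symmetric tensors as soon as all the
coefficients `α(-γ,λ_i-λ_j)` are nonzero. -/
lemma range_Rmat_neg_gamma {N : ℕ} (τ γ : ℂ) (lam : Fin N → ℂ)
    (h : ∀ i j : Fin N, i ≠ j → alphaF τ γ (-γ) (lam i - lam j) ≠ 0) :
    LinearMap.range (Matrix.mulVecLin (Rmat N τ γ (-γ) lam)) = symPair N := by
  apply le_antisymm
  · rintro _ ⟨w, rfl⟩ ⟨i, j⟩
    simp only [Matrix.mulVecLin_apply]
    rcases eq_or_ne i j with rfl | hij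
    · rfl
    · rw [Rmat_neg_gamma_mulVec_of_ne _ _ _ _ hij, Rmat_neg_gamma_mulVec_of_ne _ _ _ _ hij.symm,
        add_comm]
  · intro v hv
    refine ⟨fun p => if p.1 = p.2 then v p else
      if p.1 < p.2 then v p / alphaF τ γ (-γ) (lam p.1 - lam p.2) else 0, ?_⟩
    ext ⟨i, j⟩
    rw [Matrix.mulVecLin_apply]
    rcases lt_trichotomy i j with hij | rfl | hij
    · rw [Rmat_neg_gamma_mulVec_of_ne _ _ _ _ hij.ne]
      simp [hij, hij.ne, hij.ne', hij.not_gt, mul_div_cancel₀ _ (h i j hij.ne)]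
    · simp [Rmat_mulVec_of_eq]
    · rw [Rmat_neg_gamma_mulVec_of_ne _ _ _ _ hij.ne']
      simp [hij, hij.ne, hij.ne', hij.not_gt, mul_div_cancel₀ _ (h j i hij.ne), hv (i, j)]

/-- for generic `(γ,λ)` the image of `R(-γ,λ)` is `S²(ℂ^N)`. -/
theorem image_R_at_neg_gamma (N : ℕ) (hN : 2 ≤ N) (τ : ℂ) (hτ : 0 < τ.im) :
    ∃ U : Set (ℂ × (Fin N → ℂ)), IsOpen U ∧ Dense U ∧
      ∀ γ : ℂ, ∀ lam : Fin N → ℂ, (γ, lam) ∈ U →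
        LinearMap.range (Matrix.mulVecLin (Rmat N τ γ (-γ) lam)) = symPair N := by
  let P (i : Fin N) : (ℂ × (Fin N → ℂ)) →L[ℂ] ℂ :=
    (ContinuousLinearMap.proj i).comp (ContinuousLinearMap.snd ℂ ℂ (Fin N → ℂ))
  let G : (ℂ × (Fin N → ℂ)) →L[ℂ] ℂ := ContinuousLinearMap.fst ℂ ℂ (Fin N → ℂ)
  have hG : G ≠ 0 := fun h => by simpa [G] using DFunLike.congr_fun h (1, 0)
  have hG2 : G + G ≠ 0 := fun h => by simpa [G] using DFunLike.congr_fun h (1, 0)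
  have hP (i j : Fin N) (hij : i ≠ j) : P i - P j ≠ 0 := fun h => by
    simpa [P, hij.symm] using DFunLike.congr_fun h (0, Pi.single i 1)
  have hPG (i j : Fin N) : P i - P j + G ≠ 0 := fun h => by
    simpa [P, G] using DFunLike.congr_fun h (1, 0)
  let V (L : (ℂ × (Fin N → ℂ)) →L[ℂ] ℂ) : Set (ℂ × (Fin N → ℂ)) := {x | theta τ (L x) ≠ 0}
  have hV (L) (hL : L ≠ 0) : IsOpen (V L) ∧ Dense (V L) := isOpen_dense_theta_comp_ne_zero hτ L hL
  let W (p : Fin N × Fin N) : Set (ℂ × (Fin N → ℂ)) :=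
    if p.1 = p.2 then Set.univ else V (P p.1 - P p.2) ∩ V (P p.1 - P p.2 + G)
  have hW (p) : IsOpen (W p) ∧ Dense (W p) := by
    by_cases hp : p.1 = p.2
    · simp [W, hp]
    · have h1 := hV _ (hP _ _ hp)
      have h2 := hV _ (hPG p.1 p.2)
      simp only [W, hp, if_false]
      exact ⟨h1.1.inter h2.1, h1.2.inter_of_isOpen_left h2.2 h1.1⟩
  have hWo : IsOpen (⋂ p, W p) := isOpen_iInter_of_finite fun p => (hW p).1
  have hWd : Dense (⋂ p, W p) := dense_iInter_of_isOpen (fun p => (hW p).1) fun p => (hW p).2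
  refine ⟨(V G ∩ V (G + G)) ∩ ⋂ p, W p, ((hV _ hG).1.inter (hV _ hG2).1).inter hWo,
    ((hV _ hG).2.inter_of_isOpen_left (hV _ hG2).2 (hV _ hG).1).inter_of_isOpen_right hWd hWo, ?_⟩
  rintro γ lam ⟨⟨h1, h2⟩, h3⟩
  refine range_Rmat_neg_gamma τ γ lam fun i j hij => ?_
  have h4 := Set.mem_iInter.1 h3 (i, j)
  simp only [W, hij, if_false] at h4
  obtain ⟨h4, h5⟩ := h4
  have h1 : theta τ γ ≠ 0 := h1
  have h2 : theta τ (γ + γ) ≠ 0 := h2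
  have h4 : theta τ (lam i - lam j) ≠ 0 := h4
  have h5 : theta τ (lam i - lam j + γ) ≠ 0 := h5
  rw [alphaF, show -γ - γ = -(γ + γ) by ring, theta_neg, theta_neg]
  exact div_ne_zero (mul_ne_zero (neg_ne_zero.2 h1) h5) (mul_ne_zero (neg_ne_zero.2 h2) h4)

end EllipticQG
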